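/- arXiv:2010.08550 — 5 statements merged into one kernel-verified Lean document; each statement's English description precedes it below -/
import Mathlib

section
/- Euclid, Elements II.9: Let the straight-line AB be cut equally at C (C is the midpoint of A and B) and unequally at D (D lies between C and B). Then (dist A D)^2 + (dist D B)^2 = 2 · ((dist A C)^2 + (dist C D)^2), i.e., the squares on AD and DB are double the squares on AC and CD. -/
theorem elements_II_9 (A B C D : EuclideanSpace ℝ (Fin 2)) (hC : C = midpoint ℝ A B) (hD : Wbtw ℝ C D B) :
    (dist A D) ^ 2 + (dist D B) ^ 2 = 2 * ((dist A C) ^ 2 + (dist C D) ^ 2) := by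
  have hCB : C - B = A - C := by
    rw [hC, midpoint_sub_right, left_sub_midpoint]
  have hAD : A - D = (A - C) + (C - D) := by abel
  have hDB : D - B = (A - C) - (C - D) := by rw [← hCB]; abel
  rw [dist_eq_norm A D, dist_eq_norm D B, dist_eq_norm A C, dist_eq_norm C D, hAD, hDB]
  simpa only [sq] using parallelogram_law_with_norm ℝ (A - C) (C - D)
end

section
/- Euclid, Elements II.11 (golden ratio construction, existence form): For any two distinct points A and B, there exists a point H lying strictly between A and B such that dist A B · dist B H = (dist A H)^2, i.e., the straight-line AB can be cut so that the rectangle contained by the whole and one of the pieces equals the square on the remaining piece. -/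
theorem elements_II_11 (A B : EuclideanSpace ℝ (Fin 2)) (hAB : A ≠ B) :
    ∃ H : EuclideanSpace ℝ (Fin 2), Sbtw ℝ A H B ∧ dist A B * dist B H = (dist A H) ^ 2 := by
  obtain ⟨t, ht₀, ht₁, ht⟩ : ∃ t : ℝ, 0 < t ∧ t < 1 ∧ 1 - t = t ^ 2 := by
    refine ⟨-Real.goldenConj, ?_, ?_, ?_⟩
    · linarith [Real.goldenConj_neg]
    · linarith [Real.neg_one_lt_goldenConj]
    · linarith [Real.goldenConj_sq, neg_sq Real.goldenConj]
  refine ⟨AffineMap.lineMap A B t, sbtw_lineMap_iff.2 ⟨hAB, ht₀, ht₁⟩, ?_⟩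
  rw [dist_right_lineMap, dist_left_lineMap, Real.norm_of_nonneg ht₀.le,
    Real.norm_of_nonneg (sub_nonneg.2 ht₁.le), ht]
  ring
end

section
/- Euclid, Elements II.12 (obtuse-angle case of the cosine rule): Let B, A, C, D be points such that A lies strictly between D and C (D on the side CA produced beyond A) and the angle ∠ B D A is a right angle (BD is the perpendicular dropped from B onto CA produced, with foot D). Then (dist C B)^2 = (dist B A)^2 + (dist A C)^2 + 2 · dist C A · dist A D, i.e., the square on the side subtending the obtuse angle is greater than the squares on the sides containing the obtuse angle by twice the rectangle contained by CA, AD. -/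
open EuclideanGeometry Real

theorem elements_II_12 (B A C D : EuclideanSpace ℝ (Fin 2))
    (h1 : Sbtw ℝ D A C) (h2 : ∠ B D A = π / 2) :
    (dist C B) ^ 2 = (dist B A) ^ 2 + (dist A C) ^ 2 + 2 * dist C A * dist A D := by
  have hBDC : ∠ B D C = π / 2 := by
    rw [← h2, h1.angle_eq_right]
  have hBA := (dist_sq_eq_dist_sq_add_dist_sq_iff_angle_eq_pi_div_two B D A).2 h2
  have hBC := (dist_sq_eq_dist_sq_add_dist_sq_iff_angle_eq_pi_div_two B D C).2 hBDC
  have hDC := h1.wbtw.dist_add_dist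
  rw [dist_comm C B, dist_comm C A, dist_comm A D]
  rw [dist_comm A D] at hBA
  rw [dist_comm C D, ← hDC] at hBC
  linear_combination hBC - hBA
end

section
/- Euclid, Elements II.13 (acute-angle case of the cosine rule): Let A, B, C, D be points such that D lies strictly between B and C and the angle ∠ A D B is a right angle (AD is the perpendicular from A onto BC, with foot D falling inside BC). Then (dist A C)^2 + 2 · dist C B · dist B D = (dist C B)^2 + (dist B A)^2, i.e., the square on the side subtending the acute angle at B is less than the squares on the sides containing that angle by twice the rectangle contained by CB, BD. -/
open EuclideanGeometry Real

theorem elements_II_13 (A B C D : EuclideanSpace ℝ (Fin 2))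
    (h1 : Sbtw ℝ B D C) (h2 : ∠ A D B = π / 2) :
    (dist A C) ^ 2 + 2 * dist C B * dist B D = (dist C B) ^ 2 + (dist B A) ^ 2 := by
  have hADC : ∠ A D C = π / 2 := by
    linarith [angle_add_angle_eq_pi_of_angle_eq_pi A h1.angle₁₂₃_eq_pi]
  have hAB := (dist_sq_eq_dist_sq_add_dist_sq_iff_angle_eq_pi_div_two A D B).2 h2
  have hAC := (dist_sq_eq_dist_sq_add_dist_sq_iff_angle_eq_pi_div_two A D C).2 hADC
  have hBC := h1.wbtw.dist_add_dist
  rw [dist_comm D C] at hBC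
  rw [dist_comm C B, dist_comm B A, ← hBC]
  linear_combination hAC - hAB
end

section
/- Key lemma of Euclid, Elements II.14 (combining II.5 with the Pythagorean theorem): Let B, F be points, let G be the midpoint of B and F, let E lie between B and F, and let H be a point with dist G H = dist G F (H on the semicircle with center G and radius GF) such that the angle ∠ H E G is a right angle. Then (dist E H)^2 = dist B E · dist E F, i.e., the square on EH equals the rectangle contained by BE, EF. -/
open EuclideanGeometry Real

theorem elements_II_14_key (B F G E H : EuclideanSpace ℝ (Fin 2))
    (hG : G = midpoint ℝ B F) (hE : Wbtw ℝ B E F)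
    (hH : dist G H = dist G F) (hangle : ∠ H E G = π / 2) :
    (dist E H) ^ 2 = dist B E * dist E F := by
  obtain ⟨t, ⟨ht0, ht1⟩, rfl⟩ := hE
  have pythagoras :=
    (dist_sq_eq_dist_sq_add_dist_sq_iff_angle_eq_pi_div_two H _ G).2 hangle
  have hGF : dist G F = 1 / 2 * dist B F := by
    rw [hG, dist_midpoint_right]
    norm_num
  have hGE : dist G (AffineMap.lineMap B F t) = |1 / 2 - t| * dist B F := by
    rw [hG, midpoint, dist_lineMap_lineMap, Real.dist_eq, invOf_eq_inv, one_div]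
  have hBE : dist B (AffineMap.lineMap B F t) = t * dist B F := by
    rw [dist_left_lineMap, Real.norm_of_nonneg ht0]
  have hEF : dist (AffineMap.lineMap B F t) F = (1 - t) * dist B F := by
    rw [dist_lineMap_right, Real.norm_of_nonneg (sub_nonneg.2 ht1)]
  rw [dist_comm H G, hH, hGF, hGE, dist_comm H] at pythagoras
  rw [hBE, hEF]
  linear_combination -pythagoras - dist B F ^ 2 * sq_abs (1 / 2 - t)
end
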